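/- Let N ≥ 3. Then for every u ∈ C_c^∞(ℍ^N∖{o}) one has ∫_{ℍ^N} r^{2−N} u² dv ≤ 4 ∫_{ℍ^N} r^{2−N} |∇_r u|² dv. -/

import Mathlib

open MeasureTheory Real Set

noncomputable section

/-- The radial derivative `∇_r u = ∂u/∂r` of a function `u(r,σ)`. -/
def radGrad (N : ℕ) (u : ℝ → EuclideanSpace ℝ (Fin N) → ℝ) :
    ℝ → EuclideanSpace ℝ (Fin N) → ℝ :=
  fun r σ => deriv (fun s => u s σ) r

/-- The radial Laplacian `Δ_r u = ∂²u/∂r² + (N-1) coth r · ∂u/∂r`. -/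
def radLap (N : ℕ) (u : ℝ → EuclideanSpace ℝ (Fin N) → ℝ) :
    ℝ → EuclideanSpace ℝ (Fin N) → ℝ :=
  fun r σ => deriv (fun s => deriv (fun t => u t σ) s) r
    + ((N : ℝ) - 1) * (Real.cosh r / Real.sinh r) * deriv (fun s => u s σ) r

/-- The higher order radial derivative `∇_r^k u`: `Δ_r^{k/2} u` for even `k`,
`∂_r (Δ_r^{(k-1)/2} u)` for odd `k`. -/
def radPow (N k : ℕ) (u : ℝ → EuclideanSpace ℝ (Fin N) → ℝ) :
    ℝ → EuclideanSpace ℝ (Fin N) → ℝ :=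
  if Even k then (radLap N)^[k / 2] u else radGrad N ((radLap N)^[k / 2] u)

/-- The integral over the hyperbolic space `ℍ^N` in polar coordinates:
`∫_{S^{N-1}} ∫_0^∞ F(r,σ) (sinh r)^{N-1} dr dσ`, where `dσ` is the standard
surface measure (the `(N-1)`-dimensional Hausdorff measure) on the unit sphere. -/
def hypInt (N : ℕ) (F : ℝ → EuclideanSpace ℝ (Fin N) → ℝ) : ℝ :=
  ∫ σ in Metric.sphere (0 : EuclideanSpace ℝ (Fin N)) 1,
    (∫ r in Ioi (0 : ℝ), F r σ * Real.sinh r ^ (N - 1)) ∂μH[(N : ℝ) - 1]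

/-- `u ∈ C_c^∞(ℍ^N)`: `u(r,σ)` smooth (including at the pole `r = 0`) and
vanishing for all `r` larger than some `R`. -/
def IsCc (N : ℕ) (u : ℝ → EuclideanSpace ℝ (Fin N) → ℝ) : Prop :=
  ContDiff ℝ (⊤ : ℕ∞) (Function.uncurry u) ∧
  ∃ R : ℝ, ∀ r : ℝ, R < r → ∀ σ ∈ Metric.sphere (0 : EuclideanSpace ℝ (Fin N)) 1, u r σ = 0

/-- `u ∈ C_c^∞(ℍ^N \ {o})`: `u(r,σ)` smooth with support contained in
`[a,b] × S^{N-1}` for some `0 < a ≤ b`. -/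
def IsCcAway (N : ℕ) (u : ℝ → EuclideanSpace ℝ (Fin N) → ℝ) : Prop :=
  ContDiff ℝ (⊤ : ℕ∞) (Function.uncurry u) ∧
  ∃ a b : ℝ, 0 < a ∧ a ≤ b ∧
    ∀ r : ℝ, r ∉ Icc a b → ∀ σ ∈ Metric.sphere (0 : EuclideanSpace ℝ (Fin N)) 1, u r σ = 0

lemma hausdorffMeasure_sphere_lt_top (n : ℕ) :
    μH[(n : ℝ)] (Metric.sphere (0 : EuclideanSpace ℝ (Fin (n + 1))) 1) < ⊤ := by
  let g (i : Fin (n + 1)) (c : ℝ) (y : Fin n → ℝ) : EuclideanSpace ℝ (Fin (n + 1)) :=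
    WithLp.toLp 2 (i.insertNth c y)
  have hg (i c) : ContDiff ℝ 1 (g i c) := by
    refine contDiff_euclidean.2 fun j => ?_
    induction j using i.succAboveCases with
    | x => simpa [g] using contDiff_const
    | p j => simpa [g] using contDiff_apply ℝ ℝ j
  have hg0 (i : Fin (n + 1)) {c : ℝ} (hc : c ≠ 0) (y) : g i c y ≠ 0 := fun h => by
    have := congrArg (fun v : EuclideanSpace ℝ (Fin (n + 1)) => v i) h
    simp [g, hc] at this
  let B : Set (Fin n → ℝ) := Metric.closedBall 0 1
  let F (i : Fin (n + 1)) (c : ℝ) (y : Fin n → ℝ) : EuclideanSpace ℝ (Fin (n + 1)) :=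
    ‖g i c y‖⁻¹ • g i c y
  have hF (i) {c : ℝ} (hc : c ≠ 0) : μH[(n : ℝ)] (F i c '' B) < ⊤ := by
    have hFd : ContDiff ℝ 1 (F i c) :=
      (((hg i c).norm ℝ (hg0 i hc)).inv fun y => norm_ne_zero_iff.2 (hg0 i hc y)).smul (hg i c)
    obtain ⟨K, hK⟩ := hFd.contDiffOn.exists_lipschitzOnWith one_ne_zero
      (convex_closedBall (0 : Fin n → ℝ) 1) (isCompact_closedBall _ _)
    refine (hK.hausdorffMeasure_image_le n.cast_nonneg).trans_lt ?_
    have hvol : (μH[(n : ℝ)] : Measure (Fin n → ℝ)) = volume := by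
      simpa using hausdorffMeasure_pi_real (ι := Fin n)
    rw [hvol]
    exact ENNReal.mul_lt_top (ENNReal.rpow_lt_top_of_nonneg n.cast_nonneg ENNReal.coe_ne_top)
      measure_closedBall_lt_top
  have hcover : Metric.sphere (0 : EuclideanSpace ℝ (Fin (n + 1))) 1 ⊆
      ⋃ i, (F i 1 '' B ∪ F i (-1) '' B) := by
    intro x hx
    have hx1 : ‖x‖ = 1 := by simpa using hx
    obtain ⟨i, hi⟩ := Finite.exists_max fun i => |x i|
    have hxi : 0 < |x i| := by
      refine (abs_nonneg _).lt_of_ne fun h => ?_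
      have : x = 0 := by
        ext j
        simpa using (hi j).trans h.ge
      simp [this] at hx1
    let y : Fin n → ℝ := fun j => |x i|⁻¹ * x (i.succAbove j)
    have hyB : y ∈ B := by
      rw [mem_closedBall_zero_iff, pi_norm_le_iff_of_nonneg zero_le_one]
      intro j
      simp only [y, norm_mul, norm_inv, Real.norm_eq_abs, abs_abs]
      rw [inv_mul_le_iff₀ hxi, mul_one]
      exact hi _
    have hgy {c : ℝ} (hc : |x i|⁻¹ * x i = c) : F i c y = x := by
      have hgx : g i c y = |x i|⁻¹ • x := by
        ext j
        induction j using i.succAboveCases with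
        | x => simp [g, hc]
        | p j => simp [g, y]
      simp only [F, hgx, norm_smul, hx1, norm_inv, Real.norm_eq_abs, abs_abs, mul_one, inv_inv]
      rw [smul_smul, mul_inv_cancel₀ hxi.ne', one_smul]
    refine mem_iUnion.2 ⟨i, ?_⟩
    rcases lt_or_gt_of_ne (abs_pos.1 hxi) with h | h
    · refine Or.inr ⟨y, hyB, hgy ?_⟩
      rw [abs_of_neg h, inv_neg, neg_mul, inv_mul_cancel₀ h.ne]
    · refine Or.inl ⟨y, hyB, hgy ?_⟩
      rw [abs_of_pos h]
      field_simp
  refine (measure_mono hcover).trans_lt ?_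
  refine (measure_iUnion_fintype_le _ _).trans_lt (ENNReal.sum_lt_top.2 fun i _ => ?_)
  exact (measure_union_le _ _).trans_lt
    (ENNReal.add_lt_top.2 ⟨hF i one_ne_zero, hF i (by norm_num)⟩)

lemma sinh_le_mul_cosh {r : ℝ} (hr : 0 ≤ r) : sinh r ≤ r * cosh r := by
  have hmono : MonotoneOn (fun x : ℝ => x * cosh x - sinh x) (Ici 0) := by
    refine monotoneOn_of_deriv_nonneg (convex_Ici 0) (by fun_prop) (by fun_prop) fun x hx => ?_
    have hx0 : 0 < x := by simpa using hx
    have hd : HasDerivAt (fun x : ℝ => x * cosh x - sinh x) (x * sinh x) x := by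
      refine (((hasDerivAt_id x).mul (hasDerivAt_cosh x)).sub (hasDerivAt_sinh x)).congr_deriv ?_
      simp
    rw [hd.deriv]
    exact mul_nonneg hx0.le (sinh_nonneg_iff.2 hx0.le)
  have := hmono self_mem_Ici hr hr
  simpa using this

/-- The radial weight `r^{2-N} (sinh r)^{N-1}` grows at least exponentially with rate `1`. -/
lemma exists_hasDerivAt_radial_weight {N : ℕ} (hN : 2 ≤ N) {r : ℝ} (hr : 0 < r) :
    ∃ w', HasDerivAt (fun s : ℝ => s ^ ((2 : ℝ) - N) * sinh s ^ (N - 1)) w' r ∧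
      r ^ ((2 : ℝ) - N) * sinh r ^ (N - 1) ≤ w' := by
  obtain ⟨n, rfl⟩ := Nat.exists_eq_add_of_le hN
  refine ⟨_, (Real.hasDerivAt_rpow_const (p := (2 : ℝ) - (2 + n : ℕ)) (Or.inl hr.ne')).mul
    ((hasDerivAt_sinh r).pow (2 + n - 1)), ?_⟩
  have h1 : 2 + n - 1 = n + 1 := by omega
  rw [h1, Real.rpow_sub_one hr.ne']
  simp only [Nat.add_sub_cancel]
  push_cast
  set p : ℝ := r ^ ((2 : ℝ) - (2 + n)) with hp
  have hp0 : 0 < p := Real.rpow_pos_of_pos hr _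
  have hs : 0 < sinh r := sinh_pos_iff.2 hr
  have hq : 0 ≤ p * sinh r ^ n := by positivity
  have hdiv : sinh r / r ≤ cosh r := by
    rw [div_le_iff₀ hr, mul_comm]
    exact sinh_le_mul_cosh hr.le
  have hkey : 0 ≤ n * (cosh r - sinh r / r) + (cosh r - sinh r) :=
    add_nonneg (mul_nonneg n.cast_nonneg (sub_nonneg.2 hdiv)) (sub_nonneg.2 (sinh_lt_cosh r).le)
  have := mul_nonneg hq hkey
  rw [← sub_nonneg]
  refine this.trans_eq ?_
  field_simp
  ring

/-- A one-dimensional Hardy inequality for a weight `w` with `w ≤ w'`. -/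
lemma integral_weight_mul_sq_le {a b : ℝ} (hab : a ≤ b) {w f : ℝ → ℝ}
    (hw : ContinuousOn w (Icc a b)) (hw0 : ∀ r ∈ Icc a b, 0 ≤ w r)
    (hw' : ∀ r ∈ Icc a b, ∃ w', HasDerivAt w w' r ∧ w r ≤ w')
    (hf : ContDiff ℝ 1 f) (hfa : f a = 0) (hfb : f b = 0) :
    ∫ r in a..b, w r * f r ^ 2 ≤ 4 * ∫ r in a..b, w r * deriv f r ^ 2 := by
  have hfd : Continuous (deriv f) := hf.continuous_deriv le_rfl
  have hfc := hf.continuous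
  have hi1 : IntervalIntegrable (fun r => w r * f r ^ 2) volume a b :=
    ContinuousOn.intervalIntegrable_of_Icc hab (by fun_prop)
  have hi2 : IntervalIntegrable (fun r => w r * deriv f r ^ 2) volume a b :=
    ContinuousOn.intervalIntegrable_of_Icc hab (by fun_prop)
  have hd (r) (hr : r ∈ Ioo a b) : HasDerivAt (fun r => -2 * (w r * f r ^ 2))
      (-2 * (deriv w r * f r ^ 2 + w r * (2 * f r * deriv f r))) r := by
    obtain ⟨w', hw', -⟩ := hw' r (Ioo_subset_Icc_self hr)
    have := (hw'.mul ((hf.differentiable one_ne_zero r).hasDerivAt.pow 2)).const_mul (-2)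
    rw [hw'.deriv]
    simpa using this
  have key := intervalIntegral.sub_le_integral_of_hasDeriv_right_of_le hab
    (g := fun r => -2 * (w r * f r ^ 2)) (φ := fun r => 4 * (w r * deriv f r ^ 2) - w r * f r ^ 2)
    (by fun_prop) (fun r hr => (hd r hr).hasDerivWithinAt)
    ((intervalIntegrable_iff_integrableOn_Icc_of_le hab).1 ((hi2.const_mul 4).sub hi1))
    (fun r hr => by
      obtain ⟨w', hw', hle⟩ := hw' r (Ioo_subset_Icc_self hr)
      rw [hw'.deriv]
      have h0 := hw0 r (Ioo_subset_Icc_self hr)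
      nlinarith [mul_nonneg h0 (sq_nonneg (2 * deriv f r + f r)),
        mul_le_mul_of_nonneg_right hle (sq_nonneg (f r))])
  rw [intervalIntegral.integral_sub (hi2.const_mul 4) hi1,
    intervalIntegral.integral_const_mul] at key
  simp only [hfa, hfb] at key
  linarith

lemma continuous_radGrad {N : ℕ} {u : ℝ → EuclideanSpace ℝ (Fin N) → ℝ}
    (hu : ContDiff ℝ 1 (Function.uncurry u)) : Continuous (Function.uncurry (radGrad N u)) := by
  have h : Function.uncurry (radGrad N u) =
      fun p => fderiv ℝ (Function.uncurry u) p ((1 : ℝ), (0 : EuclideanSpace ℝ (Fin N))) := by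
    ext ⟨r, σ⟩
    have h1 := (hu.differentiable one_ne_zero (r, σ)).hasFDerivAt.comp_hasDerivAt r
      ((hasDerivAt_id r).prodMk (hasDerivAt_const r σ))
    exact h1.deriv
  rw [h]
  exact (hu.continuous_fderiv one_ne_zero).clm_apply continuous_const

lemma integral_Ioi_eq_intervalIntegral {a b : ℝ} (ha : 0 < a) (hab : a ≤ b) {G : ℝ → ℝ}
    (hG : ∀ r, r ∉ Icc a b → G r = 0) : ∫ r in Ioi 0, G r = ∫ r in a..b, G r := by
  rw [intervalIntegral.integral_of_le hab, ← integral_Icc_eq_integral_Ioc]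
  exact setIntegral_eq_of_subset_of_forall_sdiff_eq_zero measurableSet_Ioi
    (fun r hr => ha.trans_le hr.1) fun r hr => hG r hr.2

/-- The weighted Hardy-type inequality `∫ r^{2-N} u² dv ≤ 4 ∫ r^{2-N} |∇_r u|² dv`
on `ℍ^N`. -/
theorem weighted_hardy_two_sub_N (N : ℕ) (hN : 3 ≤ N)
    (u : ℝ → EuclideanSpace ℝ (Fin N) → ℝ) (hu : IsCcAway N u) :
    hypInt N (fun r σ => r ^ ((2 : ℝ) - N) * (u r σ) ^ 2) ≤
      4 * hypInt N (fun r σ => r ^ ((2 : ℝ) - N) * (radGrad N u r σ) ^ 2) := by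
  obtain ⟨hsm, a, b, ha, hab, hsupp⟩ := hu
  have hu1 : ContDiff ℝ 1 (Function.uncurry u) := hsm.of_le (by norm_cast)
  let w : ℝ → ℝ := fun r => r ^ ((2 : ℝ) - N) * sinh r ^ (N - 1)
  have ha2 : 0 < a / 2 := by positivity
  have hab' : a / 2 ≤ b + 1 := by linarith
  have hsub : Icc a b ⊆ Icc (a / 2) (b + 1) := Icc_subset_Icc (by linarith) (by linarith)
  have hpos {r : ℝ} (hr : r ∈ Icc (a / 2) (b + 1)) : 0 < r := ha2.trans_le hr.1
  have hw0 {r : ℝ} (hr : 0 < r) : 0 ≤ w r :=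
    mul_nonneg (Real.rpow_nonneg hr.le _) (pow_nonneg (sinh_nonneg_iff.2 hr.le) _)
  have hw' {r : ℝ} (hr : 0 < r) : ∃ w', HasDerivAt w w' r ∧ w r ≤ w' :=
    exists_hasDerivAt_radial_weight (by omega) hr
  have hwc {r : ℝ} (hr : 0 < r) : ContinuousAt w r := (hw' hr).choose_spec.1.continuousAt
  have hgrad (σ) (hσ : σ ∈ Metric.sphere (0 : EuclideanSpace ℝ (Fin N)) 1) (r : ℝ)
      (hr : r ∉ Icc a b) : radGrad N u r σ = 0 := by
    have : (fun s => u s σ) =ᶠ[nhds r] fun _ => 0 := by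
      filter_upwards [isClosed_Icc.isOpen_compl.mem_nhds hr] with s hs using hsupp s hs σ hσ
    simp [radGrad, this.deriv_eq]
  have hL (σ) (hσ : σ ∈ Metric.sphere (0 : EuclideanSpace ℝ (Fin N)) 1) :
      ∫ r in Ioi (0 : ℝ), r ^ ((2 : ℝ) - N) * u r σ ^ 2 * sinh r ^ (N - 1) =
        ∫ r in (a / 2)..(b + 1), w r * u r σ ^ 2 := by
    rw [integral_Ioi_eq_intervalIntegral ha2 hab' fun r hr => by
      simp [hsupp r (fun h => hr (hsub h)) σ hσ]]
    exact intervalIntegral.integral_congr fun r _ => by simp only [w]; ring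
  have hR (σ) (hσ : σ ∈ Metric.sphere (0 : EuclideanSpace ℝ (Fin N)) 1) :
      ∫ r in Ioi (0 : ℝ), r ^ ((2 : ℝ) - N) * radGrad N u r σ ^ 2 * sinh r ^ (N - 1) =
        ∫ r in (a / 2)..(b + 1), w r * radGrad N u r σ ^ 2 := by
    rw [integral_Ioi_eq_intervalIntegral ha2 hab' fun r hr => by
      simp [hgrad σ hσ r (fun h => hr (hsub h))]]
    exact intervalIntegral.integral_congr fun r _ => by simp only [w]; ring
  have hradial (σ) (hσ : σ ∈ Metric.sphere (0 : EuclideanSpace ℝ (Fin N)) 1) :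
      ∫ r in (a / 2)..(b + 1), w r * u r σ ^ 2 ≤
        4 * ∫ r in (a / 2)..(b + 1), w r * radGrad N u r σ ^ 2 := by
    refine integral_weight_mul_sq_le hab' (fun r hr => (hwc (hpos hr)).continuousWithinAt)
      (fun r hr => hw0 (hpos hr)) (fun r hr => hw' (hpos hr))
      (hu1.comp (contDiff_id.prodMk contDiff_const))
      (hsupp _ (fun h => ?_) σ hσ) (hsupp _ (fun h => ?_) σ hσ)
    · linarith [h.1]
    · linarith [h.2]
  have hcont : Continuous fun σ => ∫ r in (a / 2)..(b + 1), w r * radGrad N u r σ ^ 2 := by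
    have hwm : Continuous fun r => w (max r (a / 2)) :=
      continuous_iff_continuousAt.2 fun r => ContinuousAt.comp (g := w)
        (hwc (ha2.trans_le (le_max_right _ _))) (by fun_prop)
    have heq : (fun σ => ∫ r in (a / 2)..(b + 1), w r * radGrad N u r σ ^ 2) =
        fun σ => ∫ r in (a / 2)..(b + 1), w (max r (a / 2)) * radGrad N u r σ ^ 2 := by
      ext σ
      refine intervalIntegral.integral_congr fun r hr => ?_
      rw [uIcc_of_le hab'] at hr
      simp only [max_eq_left hr.1]
    rw [heq]
    refine intervalIntegral.continuous_parametric_intervalIntegral_of_continuous' ?_ _ _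
    exact (hwm.comp continuous_snd).mul (((continuous_radGrad hu1).comp continuous_swap).pow 2)
  have hfin : μH[(N : ℝ) - 1] (Metric.sphere (0 : EuclideanSpace ℝ (Fin N)) 1) < ⊤ := by
    obtain ⟨n, rfl⟩ := Nat.exists_eq_add_of_le' (show 1 ≤ N by omega)
    simpa using hausdorffMeasure_sphere_lt_top n
  have hint : IntegrableOn (fun σ => ∫ r in (a / 2)..(b + 1), w r * radGrad N u r σ ^ 2)
      (Metric.sphere (0 : EuclideanSpace ℝ (Fin N)) 1) μH[(N : ℝ) - 1] :=
    hcont.continuousOn.integrableOn_of_subset_isCompact (isCompact_sphere _ _)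
      Metric.isClosed_sphere.measurableSet subset_rfl hfin.ne
  unfold hypInt
  rw [setIntegral_congr_fun Metric.isClosed_sphere.measurableSet hL,
    setIntegral_congr_fun Metric.isClosed_sphere.measurableSet hR, ← integral_const_mul]
  refine integral_mono_of_nonneg ?_ (hint.const_mul 4) ?_
  · exact Filter.Eventually.of_forall fun σ => intervalIntegral.integral_nonneg hab' fun r hr =>
      mul_nonneg (hw0 (hpos hr)) (sq_nonneg _)
  · exact ae_restrict_of_forall_mem Metric.isClosed_sphere.measurableSet hradial
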